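/- arXiv:2009.01577 — 2 statements merged into one kernel-verified Lean document; each statement's English description precedes it below -/
import Mathlib

section
/- Let H be a Hopf algebra over ℂ whose antipode S is bijective and which admits a normalised left integral, i.e. a ℂ-linear functional ∫ : H → ℂ with ∫(1) = 1 and (id ⊗ ∫)∘Δ(h) = ∫(h)·1_H for all h ∈ H. Let P be a right H-comodule algebra such that the lifted canonical map ver♯ : P ⊗ P → P ⊗ H, p ⊗ q ↦ p·q_[0] ⊗ q_[1], is surjective. Then there exists a strong universal connection ω♯ : H → P ⊗ P. -/
open TensorProduct

/-- The lifted canonical map `ver♯ : P ⊗ P → P ⊗ H`, `p ⊗ q ↦ p·q₍₀₎ ⊗ q₍₁₎`,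
associated to a right coaction `ΔR : P → P ⊗ H`. -/
noncomputable def verSharp {P H : Type*} [Ring P] [Algebra ℂ P]
    [AddCommGroup H] [Module ℂ H] (ΔR : P →ₗ[ℂ] P ⊗[ℂ] H) :
    P ⊗[ℂ] P →ₗ[ℂ] P ⊗[ℂ] H :=
  (TensorProduct.map (LinearMap.mul' ℂ P) LinearMap.id) ∘ₗ
    (TensorProduct.assoc ℂ P P H).symm.toLinearMap ∘ₗ
      (TensorProduct.map LinearMap.id ΔR)

namespace HopfAlgebra

section Antipode

variable {R A : Type*} [CommSemiring R] [Semiring A] [HopfAlgebra R A]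

open Coalgebra

lemma map_antipode_comm_comul_convMul_comul :
    WithConv.toConv (TensorProduct.map (antipode R) (antipode R) ∘ₗ
      (TensorProduct.comm R A A).toLinearMap ∘ₗ comul) * WithConv.toConv comul = 1 := by
  let T : A ⊗[R] (A ⊗[R] A) →ₗ[R] A ⊗[R] A :=
    TensorProduct.lift ((LinearMap.mul R (A ⊗[R] A)).compl₂ comul ∘ₗ
        TensorProduct.map (antipode R) (antipode R) ∘ₗ (TensorProduct.comm R A A).toLinearMap) ∘ₗ
      (TensorProduct.assoc R A A A).symm.toLinearMap
  have hT (a b c : A) : T (a ⊗ₜ (b ⊗ₜ c)) = (antipode R b ⊗ₜ antipode R a) * comul c := rfl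
  let U (a : A) : A ⊗[R] (A ⊗[R] A) →ₗ[R] A ⊗[R] A :=
    TensorProduct.map (LinearMap.mul' R A ∘ₗ (antipode R).rTensor A)
      (LinearMap.mulLeft R (antipode R a)) ∘ₗ (TensorProduct.assoc R A A A).symm.toLinearMap
  have hU (a b : A) (x : A ⊗[R] A) :
      U a (b ⊗ₜ x) = (antipode R b ⊗ₜ antipode R a) * x := by
    induction x with
    | zero => simp
    | add x y hx hy => rw [tmul_add, map_add, hx, hy, mul_add]
    | tmul x y => simp [U]
  have key (a k : A) : T (a ⊗ₜ comul k) = 1 ⊗ₜ (antipode R a * k) := by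
    have h1 (x : A ⊗[R] A) : T (a ⊗ₜ x) = U a (comul.lTensor A x) := by
      induction x with
      | zero => simp
      | add x y hx hy => rw [tmul_add, map_add, hx, hy, map_add, map_add]
      | tmul x y => rw [LinearMap.lTensor_tmul, hU, hT]
    have h2 (x : A ⊗[R] A) : U a (TensorProduct.assoc R A A A (comul.rTensor A x)) =
        (1 : A) ⊗ₜ (antipode R a * TensorProduct.lid R A (counit.rTensor A x)) := by
      induction x with
      | zero => simp
      | add x y hx hy => simp only [map_add, hx, hy, mul_add, tmul_add]
      | tmul x y =>
        simp [U, Algebra.algebraMap_eq_smul_one, smul_tmul]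
    rw [h1, ← coassoc_apply, h2]
    simp
  have h3 (x : A ⊗[R] A) : LinearMap.mul' R (A ⊗[R] A) (TensorProduct.map
      (TensorProduct.map (antipode R) (antipode R) ∘ₗ
        (TensorProduct.comm R A A).toLinearMap ∘ₗ comul) comul x) =
      T (TensorProduct.assoc R A A A (comul.rTensor A x)) := by
    induction x with
    | zero => simp
    | add x y hx hy => simp only [map_add, hx, hy]
    | tmul x y => simp [T]
  have h4 (x : A ⊗[R] A) : T (comul.lTensor A x) =
      1 ⊗ₜ LinearMap.mul' R A ((antipode R).rTensor A x) := by
    induction x with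
    | zero => simp
    | add x y hx hy => simp only [map_add, hx, hy, tmul_add]
    | tmul x y => simp [key]
  ext h
  rw [LinearMap.convMul_apply]
  simp only
  rw [h3, coassoc_apply, h4]
  simp [Algebra.algebraMap_eq_smul_one, Algebra.TensorProduct.one_def]

/-- The antipode is an anti-coalgebra map. -/
lemma comul_antipode (a : A) :
    comul (antipode R a) = TensorProduct.map (antipode R) (antipode R)
      (TensorProduct.comm R A A (comul a)) :=
  (congr($(left_inv_eq_right_inv map_antipode_comm_comul_convMul_comul
    (LinearMap.comul_right_inv (R := R) (C := A))) a)).symm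

/-- If `int` is a left integral, then `a₁ ∫ (a₂ S b) = ∫ (a S b₁) b₂`. -/
lemma leftIntegral_mul_antipode (int : A →ₗ[R] R)
    (hint : ∀ a : A,
      TensorProduct.rid R A (int.lTensor A (comul (R := R) a)) = int a • (1 : A)) (a b : A) :
    TensorProduct.rid R A (int.lTensor A (comul a * 1 ⊗ₜ[R] antipode R b)) =
      TensorProduct.lid R A
        ((int ∘ₗ LinearMap.mulLeft R a ∘ₗ antipode R).rTensor A (comul b)) := by
  let T : A ⊗[R] (A ⊗[R] A) →ₗ[R] A :=
    LinearMap.mul' R A ∘ₗ LinearMap.rTensor A ((TensorProduct.rid R A).toLinearMap ∘ₗ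
      int.lTensor A ∘ₗ LinearMap.mulLeft R (comul a) ∘ₗ
        TensorProduct.map (antipode R) (antipode R) ∘ₗ (TensorProduct.comm R A A).toLinearMap) ∘ₗ
      (TensorProduct.assoc R A A A).symm.toLinearMap
  have hT (x y z : A) : T (x ⊗ₜ (y ⊗ₜ z)) =
    TensorProduct.rid R A (int.lTensor A (comul a * (antipode R y ⊗ₜ antipode R x))) * z := rfl
  have key (p : A) (x : A ⊗[R] A) : T (p ⊗ₜ x) =
      TensorProduct.rid R A (int.lTensor A (comul a * 1 ⊗ₜ[R] antipode R p)) *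
        LinearMap.mul' R A ((antipode R).rTensor A x) := by
    induction x with
    | zero => simp
    | add x y hx hy => simp only [tmul_add, map_add, hx, hy, mul_add]
    | tmul x y =>
      rw [hT]
      generalize comul (R := R) a = z
      induction z with
      | zero => simp
      | add z w hz hw => simp only [map_add, hz, hw, add_mul]
      | tmul z w => simp [mul_assoc]
  have h1 (x : A ⊗[R] A) : T (TensorProduct.assoc R A A A (comul.rTensor A x)) =
      TensorProduct.lid R A ((int ∘ₗ LinearMap.mulLeft R a ∘ₗ antipode R).rTensor A x) := by
    induction x with
    | zero => simp
    | add x y hx hy => simp only [map_add, hx, hy]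
    | tmul x y =>
      have : T (TensorProduct.assoc R A A A (comul x ⊗ₜ y)) =
          TensorProduct.rid R A (int.lTensor A (comul a * TensorProduct.map (antipode R)
            (antipode R) (TensorProduct.comm R A A (comul x)))) * y := by
        simp [T]
      rw [LinearMap.rTensor_tmul, this, ← comul_antipode, ← Bialgebra.comul_mul, hint]
      simp
  have h2 (x : A ⊗[R] A) : T (comul.lTensor A x) =
      TensorProduct.rid R A (int.lTensor A (comul a *
        1 ⊗ₜ[R] antipode R (TensorProduct.rid R A (counit.lTensor A x)))) := by
    induction x with
    | zero => simp
    | add x y hx hy =>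
      simp only [map_add, hx, hy, tmul_add, mul_add]
    | tmul x y => simp [key, Algebra.algebraMap_eq_smul_one]
  rw [← h1, coassoc_apply, h2]
  simp

end Antipode

section Average

variable {R A : Type*} [CommSemiring R] [Semiring A] [HopfAlgebra R A] (int : A →ₗ[R] R)
  {V V' W W' M : Type*} [AddCommMonoid V] [Module R V] [AddCommMonoid V'] [Module R V']
  [AddCommMonoid W] [Module R W] [AddCommMonoid W'] [Module R W'] [AddCommMonoid M] [Module R M]
  {ρV : V →ₗ[R] V ⊗[R] A} {ρV' : V' →ₗ[R] V' ⊗[R] A}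
  {ρW : W →ₗ[R] W ⊗[R] A} {ρW' : W' →ₗ[R] W' ⊗[R] A}

open Coalgebra

/-- The map `(w ⊗ a) ⊗ b ↦ ∫ (a S b) w`. -/
noncomputable def integralPairing (W : Type*) [AddCommMonoid W] [Module R W] :
    (W ⊗[R] A) ⊗[R] A →ₗ[R] W :=
  (TensorProduct.rid R W).toLinearMap ∘ₗ
    (int ∘ₗ LinearMap.mul' R A ∘ₗ (antipode R).lTensor A).lTensor W ∘ₗ
      (TensorProduct.assoc R W A A).toLinearMap

@[simp]
lemma integralPairing_tmul (w : W) (a b : A) :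
    integralPairing int W (w ⊗ₜ a ⊗ₜ b) = int (a * antipode R b) • w := by
  simp [integralPairing]

lemma comp_integralPairing (φ : W →ₗ[R] W') :
    φ ∘ₗ integralPairing int W = integralPairing int W' ∘ₗ (φ.rTensor A).rTensor A := by
  ext; simp

lemma integralPairing_comul_left (hint : ∀ a : A,
      TensorProduct.rid R A (int.lTensor A (comul (R := R) a)) = int a • (1 : A))
    (t : W ⊗[R] A) (b : A) :
    integralPairing int (W ⊗[R] A) ((TensorProduct.assoc R W A A).symm (comul.lTensor W t) ⊗ₜ b) =
      (integralPairing int W).rTensor A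
        ((TensorProduct.assoc R (W ⊗[R] A) A A).symm (t ⊗ₜ comul b)) := by
  induction t with
  | zero => simp
  | add x y hx hy => simp only [map_add, add_tmul, hx, hy]
  | tmul w a =>
    have h1 (y : A ⊗[R] A) : integralPairing int (W ⊗[R] A)
        ((TensorProduct.assoc R W A A).symm (w ⊗ₜ y) ⊗ₜ b) =
          w ⊗ₜ TensorProduct.rid R A (int.lTensor A (y * 1 ⊗ₜ[R] antipode R b)) := by
      induction y with
      | zero => simp
      | add x y hx hy => simp only [map_add, add_tmul, tmul_add, hx, hy, add_mul]
      | tmul x y => simp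
    have h2 (y : A ⊗[R] A) : (integralPairing int W).rTensor A
        ((TensorProduct.assoc R (W ⊗[R] A) A A).symm ((w ⊗ₜ a) ⊗ₜ y)) =
          w ⊗ₜ TensorProduct.lid R A
            ((int ∘ₗ LinearMap.mulLeft R a ∘ₗ antipode R).rTensor A y) := by
      induction y with
      | zero => simp
      | add x y hx hy => simp only [map_add, tmul_add, hx, hy]
      | tmul x y => simp [smul_tmul]
    rw [LinearMap.lTensor_tmul, h1, h2, leftIntegral_mul_antipode int hint]

/-- The average `v ↦ f(v₀)₀ ∫ (f(v₀)₁ S v₁)` of a linear map between right comodules. -/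
noncomputable def average (ρV : V →ₗ[R] V ⊗[R] A) (ρW : W →ₗ[R] W ⊗[R] A) (f : V →ₗ[R] W) :
    V →ₗ[R] W :=
  integralPairing int W ∘ₗ (ρW ∘ₗ f).rTensor A ∘ₗ ρV

lemma comp_average {φ : W →ₗ[R] W'} (hφ : ρW' ∘ₗ φ = φ.rTensor A ∘ₗ ρW) (f : V →ₗ[R] W) :
    φ ∘ₗ average int ρV ρW f = average int ρV ρW' (φ ∘ₗ f) := by
  rw [average, average, ← LinearMap.comp_assoc, comp_integralPairing, ← LinearMap.comp_assoc f φ,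
    hφ, LinearMap.comp_assoc, LinearMap.comp_assoc]
  simp only [LinearMap.rTensor_comp, LinearMap.comp_assoc]

lemma average_comp {ψ : V' →ₗ[R] V} (hψ : ρV ∘ₗ ψ = ψ.rTensor A ∘ₗ ρV') (f : V →ₗ[R] W) :
    average int ρV ρW f ∘ₗ ψ = average int ρV' ρW (f ∘ₗ ψ) := by
  simp only [average, LinearMap.comp_assoc, hψ, LinearMap.rTensor_comp]

/-- The average of a linear map is colinear. -/
lemma average_colinear (hint : ∀ a : A,
      TensorProduct.rid R A (int.lTensor A (comul (R := R) a)) = int a • (1 : A))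
    (hV : ρV.rTensor A ∘ₗ ρV = (TensorProduct.assoc R V A A).symm.toLinearMap ∘ₗ
      comul.lTensor V ∘ₗ ρV)
    (hW : ρW.rTensor A ∘ₗ ρW = (TensorProduct.assoc R W A A).symm.toLinearMap ∘ₗ
      comul.lTensor W ∘ₗ ρW) (f : V →ₗ[R] W) :
    ρW ∘ₗ average int ρV ρW f = (average int ρV ρW f).rTensor A ∘ₗ ρV := by
  have key (x : V ⊗[R] A) : ρW (integralPairing int W ((ρW ∘ₗ f).rTensor A x)) =
      (integralPairing int W ∘ₗ (ρW ∘ₗ f).rTensor A).rTensor A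
        ((TensorProduct.assoc R V A A).symm (comul.lTensor V x)) := by
    induction x with
    | zero => simp
    | add x y hx hy => simp only [map_add, hx, hy]
    | tmul v b =>
      have h1 := congr($(comp_integralPairing int ρW) (ρW (f v) ⊗ₜ b))
      have h2 := congr($hW (f v))
      simp only [LinearMap.comp_apply, LinearMap.rTensor_tmul, LinearEquiv.coe_coe] at h1 h2
      rw [LinearMap.rTensor_tmul, LinearMap.comp_apply, h1, h2, integralPairing_comul_left int hint,
        LinearMap.lTensor_tmul]
      generalize comul (R := R) b = y
      induction y with
      | zero => simp
      | add x y hx hy => simp only [tmul_add, map_add, hx, hy]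
      | tmul x y => simp
  ext v
  have h := congr($hV v)
  simp only [LinearMap.comp_apply, LinearEquiv.coe_coe] at h
  rw [LinearMap.comp_apply, average, LinearMap.comp_apply, LinearMap.comp_apply, key, ← h,
    ← LinearMap.rTensor_comp_apply]
  rfl

/-- Averaging does not change a colinear map. -/
lemma average_eq_self (hint : int 1 = 1)
    (hV : ρV.rTensor A ∘ₗ ρV = (TensorProduct.assoc R V A A).symm.toLinearMap ∘ₗ
      comul.lTensor V ∘ₗ ρV)
    (hV' : (TensorProduct.rid R V).toLinearMap ∘ₗ counit.lTensor V ∘ₗ ρV = LinearMap.id)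
    {f : V →ₗ[R] W} (hf : ρW ∘ₗ f = f.rTensor A ∘ₗ ρV) :
    average int ρV ρW f = f := by
  have key : integralPairing int V ∘ₗ (TensorProduct.assoc R V A A).symm.toLinearMap ∘ₗ
      comul.lTensor V = (TensorProduct.rid R V).toLinearMap ∘ₗ counit.lTensor V := by
    ext v a
    have h1 (y : A ⊗[R] A) : integralPairing int V ((TensorProduct.assoc R V A A).symm (v ⊗ₜ y)) =
        int (LinearMap.mul' R A ((antipode R).lTensor A y)) • v := by
      induction y with
      | zero => simp
      | add x y hx hy => simp only [map_add, tmul_add, hx, hy, add_smul]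
      | tmul x y => simp
    simp [h1, Algebra.algebraMap_eq_smul_one, hint]
  have h := comp_average int (ρV := ρV) hf LinearMap.id
  rw [LinearMap.comp_id] at h
  have hid : average int ρV ρV LinearMap.id = LinearMap.id := by
    rw [average, LinearMap.comp_id, hV, ← hV']
    simp only [← LinearMap.comp_assoc] at key ⊢
    rw [key]
  rw [← h, hid, LinearMap.comp_id]

lemma average_apply_eq_self (hint : int 1 = 1) {v : V} {w : W} (hv : ρV v = v ⊗ₜ 1)
    (hw : ρW w = w ⊗ₜ 1) {f : V →ₗ[R] W} (hf : f v = w) : average int ρV ρW f v = w := by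
  simp [average, hv, hw, hf, hint]

lemma average_rTensor (f : V →ₗ[R] W) :
    average int ((TensorProduct.rightComm R V A M).toLinearMap ∘ₗ ρV.rTensor M)
      ((TensorProduct.rightComm R W A M).toLinearMap ∘ₗ ρW.rTensor M) (f.rTensor M) =
        (average int ρV ρW f).rTensor M := by
  have key (m : M) (x : V ⊗[R] A) : integralPairing int (W ⊗[R] M)
      (((TensorProduct.rightComm R W A M).toLinearMap ∘ₗ ρW.rTensor M ∘ₗ f.rTensor M).rTensor A
        (TensorProduct.rightComm R V A M (x ⊗ₜ m))) =
      integralPairing int W ((ρW ∘ₗ f).rTensor A x) ⊗ₜ m := by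
    induction x with
    | zero => simp
    | add x y hx hy => simp only [add_tmul, map_add, hx, hy]
    | tmul v a =>
      simp only [TensorProduct.rightComm_tmul, LinearMap.rTensor_tmul, LinearMap.comp_apply,
        LinearEquiv.coe_coe]
      generalize ρW (f v) = y
      induction y with
      | zero => simp
      | add x y hx hy => simp only [add_tmul, map_add, hx, hy]
      | tmul x y => simp [smul_tmul']
  ext v m
  exact key m (ρV v)

/-- Averaging preserves compatibility with maps that commute with the coactions. -/
lemma average_comm {TV : V →ₗ[R] V ⊗[R] M} {TW : W →ₗ[R] W ⊗[R] M}
    (hV : TV.rTensor A ∘ₗ ρV = (TensorProduct.rightComm R V A M).toLinearMap ∘ₗ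
      ρV.rTensor M ∘ₗ TV)
    (hW : TW.rTensor A ∘ₗ ρW = (TensorProduct.rightComm R W A M).toLinearMap ∘ₗ
      ρW.rTensor M ∘ₗ TW)
    {f : V →ₗ[R] W} (hf : TW ∘ₗ f = f.rTensor M ∘ₗ TV) :
    TW ∘ₗ average int ρV ρW f = (average int ρV ρW f).rTensor M ∘ₗ TV := by
  rw [comp_average int ((LinearMap.comp_assoc _ _ _).trans hW.symm), hf, ← average_rTensor,
    average_comp int ((LinearMap.comp_assoc _ _ _).trans hV.symm)]

end Average

section Coactions

variable {R A : Type*} [CommSemiring R] [Semiring A] [HopfAlgebra R A]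
  {M P : Type*} [AddCommMonoid M] [Module R M] [AddCommMonoid P] [Module R P]

open Coalgebra

variable (R A) in
/-- The right coaction `h ↦ h₂ ⊗ S h₁` of a Hopf algebra on itself. -/
noncomputable def antipodeCoaction : A →ₗ[R] A ⊗[R] A :=
  (antipode R).lTensor A ∘ₗ (TensorProduct.comm R A A).toLinearMap ∘ₗ comul

lemma antipodeCoaction_coassoc :
    (antipodeCoaction R A).rTensor A ∘ₗ antipodeCoaction R A =
      (TensorProduct.assoc R A A A).symm.toLinearMap ∘ₗ comul.lTensor A ∘ₗ
        antipodeCoaction R A := by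
  let T : A ⊗[R] (A ⊗[R] A) →ₗ[R] (A ⊗[R] A) ⊗[R] A :=
    (TensorProduct.assoc R A A A).symm.toLinearMap ∘ₗ
      TensorProduct.map LinearMap.id (TensorProduct.map (antipode R) (antipode R)) ∘ₗ
        (TensorProduct.assoc R A A A).toLinearMap ∘ₗ
        (TensorProduct.comm R A A).toLinearMap.rTensor A ∘ₗ
        (TensorProduct.comm R A (A ⊗[R] A)).toLinearMap
  have h1 (x : A ⊗[R] A) : (antipodeCoaction R A).rTensor A
      ((antipode R).lTensor A (TensorProduct.comm R A A x)) = T (comul.lTensor A x) := by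
    induction x with
    | zero => simp
    | add x y hx hy => simp only [map_add, hx, hy]
    | tmul a b =>
      simp only [antipodeCoaction, T, LinearMap.comp_apply, LinearMap.lTensor_tmul,
        LinearMap.rTensor_tmul, TensorProduct.comm_tmul, LinearEquiv.coe_coe]
      generalize comul (R := R) b = y
      induction y with
      | zero => simp
      | add x y hx hy => simp only [add_tmul, map_add, hx, hy]
      | tmul x y => simp
  have h2 (x : A ⊗[R] A) : (TensorProduct.assoc R A A A).symm (comul.lTensor A
      ((antipode R).lTensor A (TensorProduct.comm R A A x))) =
        T (TensorProduct.assoc R A A A (comul.rTensor A x)) := by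
    induction x with
    | zero => simp
    | add x y hx hy => simp only [map_add, hx, hy]
    | tmul a b =>
      simp only [T, LinearMap.comp_apply, LinearMap.lTensor_tmul, comul_antipode,
        LinearMap.rTensor_tmul, TensorProduct.comm_tmul, LinearEquiv.coe_coe]
      generalize comul (R := R) a = y
      induction y with
      | zero => simp
      | add x y hx hy => simp only [tmul_add, add_tmul, map_add, hx, hy]
      | tmul x y => simp
  ext a
  have h := coassoc_apply (R := R) a
  calc _ = T (comul.lTensor A (comul a)) := h1 _
    _ = _ := by rw [← h, ← h2]; rfl

lemma antipodeCoaction_counit :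
    (TensorProduct.rid R A).toLinearMap ∘ₗ counit.lTensor A ∘ₗ antipodeCoaction R A =
      LinearMap.id := by
  have h1 (x : A ⊗[R] A) : TensorProduct.rid R A (counit.lTensor A
      ((antipode R).lTensor A (TensorProduct.comm R A A x))) =
        TensorProduct.lid R A (counit.rTensor A x) := by
    induction x with
    | zero => simp
    | add x y hx hy => simp only [map_add, hx, hy]
    | tmul a b => simp
  ext a
  exact (h1 (comul a)).trans (by simp)

lemma antipodeCoaction_comm :
    comul.rTensor A ∘ₗ antipodeCoaction R A =
      (TensorProduct.rightComm R A A A).toLinearMap ∘ₗ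
        (antipodeCoaction R A).rTensor A ∘ₗ comul := by
  let T : A ⊗[R] (A ⊗[R] A) →ₗ[R] (A ⊗[R] A) ⊗[R] A :=
    (antipode R).lTensor (A ⊗[R] A) ∘ₗ (TensorProduct.comm R A (A ⊗[R] A)).toLinearMap
  have h1 (x : A ⊗[R] A) : comul.rTensor A
      ((antipode R).lTensor A (TensorProduct.comm R A A x)) = T (comul.lTensor A x) := by
    induction x with
    | zero => simp
    | add x y hx hy => simp only [map_add, hx, hy]
    | tmul a b => simp [T]
  have h2 (x : A ⊗[R] A) : TensorProduct.rightComm R A A A ((antipodeCoaction R A).rTensor A x) =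
      T (TensorProduct.assoc R A A A (comul.rTensor A x)) := by
    induction x with
    | zero => simp
    | add x y hx hy => simp only [map_add, hx, hy]
    | tmul a b =>
      simp only [antipodeCoaction, T, LinearMap.comp_apply, LinearMap.rTensor_tmul,
        LinearEquiv.coe_coe]
      generalize comul (R := R) a = y
      induction y with
      | zero => simp
      | add x y hx hy => simp only [add_tmul, map_add, hx, hy]
      | tmul x y => simp
  ext a
  calc _ = T (comul.lTensor A (comul a)) := h1 _
    _ = _ := by rw [← coassoc_apply, ← h2]; rfl

/-- The right coaction on `M ⊗ P` induced by a right coaction on `P`. -/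
noncomputable def coactionRight (M : Type*) [AddCommMonoid M] [Module R M]
    (ρ : P →ₗ[R] P ⊗[R] A) : M ⊗[R] P →ₗ[R] (M ⊗[R] P) ⊗[R] A :=
  (TensorProduct.assoc R M P A).symm.toLinearMap ∘ₗ ρ.lTensor M

/-- The right coaction on `P ⊗ M` induced by a right coaction on `P`. -/
noncomputable def coactionLeft (M : Type*) [AddCommMonoid M] [Module R M]
    (ρ : P →ₗ[R] P ⊗[R] A) : P ⊗[R] M →ₗ[R] (P ⊗[R] M) ⊗[R] A :=
  (TensorProduct.rightComm R P A M).toLinearMap ∘ₗ ρ.rTensor M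

variable {ρ : P →ₗ[R] P ⊗[R] A}

lemma coactionRight_coassoc (hρ : ρ.rTensor A ∘ₗ ρ =
      (TensorProduct.assoc R P A A).symm.toLinearMap ∘ₗ comul.lTensor P ∘ₗ ρ) :
    (coactionRight M ρ).rTensor A ∘ₗ coactionRight M ρ =
      (TensorProduct.assoc R (M ⊗[R] P) A A).symm.toLinearMap ∘ₗ comul.lTensor (M ⊗[R] P) ∘ₗ
        coactionRight M ρ := by
  let T (m : M) : (P ⊗[R] A) ⊗[R] A →ₗ[R] ((M ⊗[R] P) ⊗[R] A) ⊗[R] A :=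
    ((TensorProduct.mk R M P m).rTensor A).rTensor A
  have h1 (m : M) (x : P ⊗[R] A) : (coactionRight M ρ).rTensor A
      ((TensorProduct.assoc R M P A).symm (m ⊗ₜ x)) = T m (ρ.rTensor A x) := by
    induction x with
    | zero => simp
    | add x y hx hy => simp only [map_add, tmul_add, hx, hy]
    | tmul p a =>
      simp only [coactionRight, T, LinearMap.comp_apply, LinearMap.rTensor_tmul,
        LinearMap.lTensor_tmul, TensorProduct.assoc_symm_tmul, LinearEquiv.coe_coe]
      generalize ρ p = y
      induction y with
      | zero => simp
      | add x y hx hy => simp only [add_tmul, tmul_add, map_add, hx, hy]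
      | tmul x y => simp
  have h2 (m : M) (x : P ⊗[R] A) : (TensorProduct.assoc R (M ⊗[R] P) A A).symm
      (comul.lTensor (M ⊗[R] P) ((TensorProduct.assoc R M P A).symm (m ⊗ₜ x))) =
        T m ((TensorProduct.assoc R P A A).symm (comul.lTensor P x)) := by
    induction x with
    | zero => simp
    | add x y hx hy => simp only [map_add, tmul_add, hx, hy]
    | tmul p a =>
      simp only [T, LinearMap.lTensor_tmul, TensorProduct.assoc_symm_tmul]
      generalize comul (R := R) a = y
      induction y with
      | zero => simp
      | add x y hx hy => simp only [tmul_add, map_add, hx, hy]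
      | tmul x y => simp
  ext m p
  have h := congr($hρ p)
  simp only [LinearMap.comp_apply, LinearEquiv.coe_coe] at h
  calc _ = T m (ρ.rTensor A (ρ p)) := h1 m _
    _ = _ := by rw [h, ← h2]; rfl

lemma coactionLeft_coassoc (hρ : ρ.rTensor A ∘ₗ ρ =
      (TensorProduct.assoc R P A A).symm.toLinearMap ∘ₗ comul.lTensor P ∘ₗ ρ) :
    (coactionLeft M ρ).rTensor A ∘ₗ coactionLeft M ρ =
      (TensorProduct.assoc R (P ⊗[R] M) A A).symm.toLinearMap ∘ₗ comul.lTensor (P ⊗[R] M) ∘ₗ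
        coactionLeft M ρ := by
  let T (m : M) : (P ⊗[R] A) ⊗[R] A →ₗ[R] ((P ⊗[R] M) ⊗[R] A) ⊗[R] A :=
    (((TensorProduct.mk R P M).flip m).rTensor A).rTensor A
  have h1 (m : M) (x : P ⊗[R] A) : (coactionLeft M ρ).rTensor A
      (TensorProduct.rightComm R P A M (x ⊗ₜ m)) = T m (ρ.rTensor A x) := by
    induction x with
    | zero => simp
    | add x y hx hy => simp only [map_add, add_tmul, hx, hy]
    | tmul p a =>
      simp only [coactionLeft, T, LinearMap.comp_apply, LinearMap.rTensor_tmul,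
        TensorProduct.rightComm_tmul, LinearEquiv.coe_coe]
      generalize ρ p = y
      induction y with
      | zero => simp
      | add x y hx hy => simp only [add_tmul, map_add, hx, hy]
      | tmul x y => simp
  have h2 (m : M) (x : P ⊗[R] A) : (TensorProduct.assoc R (P ⊗[R] M) A A).symm
      (comul.lTensor (P ⊗[R] M) (TensorProduct.rightComm R P A M (x ⊗ₜ m))) =
        T m ((TensorProduct.assoc R P A A).symm (comul.lTensor P x)) := by
    induction x with
    | zero => simp
    | add x y hx hy => simp only [map_add, add_tmul, hx, hy]
    | tmul p a =>
      simp only [T, LinearMap.lTensor_tmul, TensorProduct.rightComm_tmul]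
      generalize comul (R := R) a = y
      induction y with
      | zero => simp
      | add x y hx hy => simp only [tmul_add, map_add, hx, hy]
      | tmul x y => simp
  ext p m
  have h := congr($hρ p)
  simp only [LinearMap.comp_apply, LinearEquiv.coe_coe] at h
  calc _ = T m (ρ.rTensor A (ρ p)) := h1 m _
    _ = _ := by rw [h, ← h2]; rfl

lemma coactionRight_comm_coactionLeft :
    (coactionRight P ρ).rTensor A ∘ₗ coactionLeft P ρ =
      (TensorProduct.rightComm R (P ⊗[R] P) A A).toLinearMap ∘ₗ
        (coactionLeft P ρ).rTensor A ∘ₗ coactionRight P ρ := by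
  have key (x y : P ⊗[R] A) : (TensorProduct.assoc R P P A).symm.toLinearMap.rTensor A
      (TensorProduct.rightComm R P A (P ⊗[R] A) (x ⊗ₜ y)) =
        TensorProduct.rightComm R (P ⊗[R] P) A A
          ((TensorProduct.rightComm R P A P).toLinearMap.rTensor A
            ((TensorProduct.assoc R (P ⊗[R] A) P A).symm (x ⊗ₜ y))) := by
    induction x with
    | zero => simp
    | add x y hx hy => simp only [add_tmul, map_add, hx, hy]
    | tmul p a =>
      induction y with
      | zero => simp
      | add x y hx hy => simp only [tmul_add, map_add, hx, hy]
      | tmul q b => simp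
  have h1 (x : P ⊗[R] A) (q : P) : (coactionRight P ρ).rTensor A
      (TensorProduct.rightComm R P A P (x ⊗ₜ q)) =
        (TensorProduct.assoc R P P A).symm.toLinearMap.rTensor A
          (TensorProduct.rightComm R P A (P ⊗[R] A) (x ⊗ₜ ρ q)) := by
    induction x with
    | zero => simp
    | add x y hx hy => simp only [add_tmul, map_add, hx, hy]
    | tmul p a => simp [coactionRight]
  have h2 (p : P) (y : P ⊗[R] A) : (coactionLeft P ρ).rTensor A
      ((TensorProduct.assoc R P P A).symm (p ⊗ₜ y)) =
        (TensorProduct.rightComm R P A P).toLinearMap.rTensor A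
            ((TensorProduct.assoc R (P ⊗[R] A) P A).symm (ρ p ⊗ₜ y)) := by
    induction y with
    | zero => simp
    | add x y hx hy => simp only [tmul_add, map_add, hx, hy]
    | tmul q b => simp [coactionLeft]
  ext p q
  calc _ = _ := h1 (ρ p) q
    _ = _ := key _ _
    _ = _ := by rw [← h2]; rfl

end Coactions

section Canonical

open Coalgebra

lemma lTensor_mul_leftComm_antipodeCoaction {R A : Type*} [CommSemiring R] [Semiring A]
    [HopfAlgebra R A] (c : A) :
    (LinearMap.mul' R A).lTensor A (TensorProduct.leftComm R A A A
      ((antipodeCoaction R A).lTensor A (comul c))) = c ⊗ₜ 1 := by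
  let T : A ⊗[R] (A ⊗[R] A) →ₗ[R] A ⊗[R] A :=
    (TensorProduct.comm R A A).toLinearMap ∘ₗ
      (LinearMap.mul' R A ∘ₗ (antipode R).lTensor A).rTensor A ∘ₗ
        (TensorProduct.assoc R A A A).symm.toLinearMap
  have h1 (x : A ⊗[R] A) : (LinearMap.mul' R A).lTensor A (TensorProduct.leftComm R A A A
      ((antipodeCoaction R A).lTensor A x)) = T (comul.lTensor A x) := by
    induction x with
    | zero => simp
    | add x y hx hy => simp only [map_add, hx, hy]
    | tmul a b =>
      simp only [antipodeCoaction, T, LinearMap.comp_apply, LinearMap.lTensor_tmul,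
        LinearEquiv.coe_coe]
      generalize comul (R := R) b = y
      induction y with
      | zero => simp
      | add x y hx hy => simp only [tmul_add, map_add, hx, hy]
      | tmul x y => simp
  have h2 (x : A ⊗[R] A) : T (TensorProduct.assoc R A A A (comul.rTensor A x)) =
      TensorProduct.lid R A (counit.rTensor A x) ⊗ₜ 1 := by
    induction x with
    | zero => simp
    | add x y hx hy => simp only [map_add, add_tmul, hx, hy]
    | tmul a b => simp [T, Algebra.algebraMap_eq_smul_one, smul_tmul]
  rw [h1, ← coassoc_apply, h2]
  simp

variable {H P : Type*} [Ring H] [HopfAlgebra ℂ H] [Ring P] [Algebra ℂ P]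

lemma verSharp_tmul (ρ : P →ₗ[ℂ] P ⊗[ℂ] H) (p q : P) :
    verSharp ρ (p ⊗ₜ q) = (LinearMap.mulLeft ℂ p).rTensor H (ρ q) := by
  simp only [verSharp, LinearMap.comp_apply, TensorProduct.map_tmul, LinearMap.id_apply,
    LinearEquiv.coe_coe]
  generalize ρ q = y
  induction y with
  | zero => simp
  | add x y hx hy => simp only [tmul_add, map_add, hx, hy]
  | tmul x y => simp

/-- The canonical map is colinear for the coactions on the right tensor factors. -/
lemma coactionRight_comp_verSharp {ρ : P →ₗ[ℂ] P ⊗[ℂ] H} (hρ : ρ.rTensor H ∘ₗ ρ =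
      (TensorProduct.assoc ℂ P H H).symm.toLinearMap ∘ₗ comul.lTensor P ∘ₗ ρ) :
    coactionRight P (comul (R := ℂ) (A := H)) ∘ₗ verSharp ρ =
      (verSharp ρ).rTensor H ∘ₗ coactionRight P ρ := by
  let T (p : P) : (P ⊗[ℂ] H) ⊗[ℂ] H →ₗ[ℂ] (P ⊗[ℂ] H) ⊗[ℂ] H :=
    ((LinearMap.mulLeft ℂ p).rTensor H).rTensor H
  have h1 (p : P) (x : P ⊗[ℂ] H) : (verSharp ρ).rTensor H
      ((TensorProduct.assoc ℂ P P H).symm (p ⊗ₜ x)) = T p (ρ.rTensor H x) := by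
    induction x with
    | zero => simp
    | add x y hx hy => simp only [tmul_add, map_add, hx, hy]
    | tmul q a => simp [T, verSharp_tmul]
  have h2 (p : P) (x : P ⊗[ℂ] H) : coactionRight P (comul (R := ℂ) (A := H))
      ((LinearMap.mulLeft ℂ p).rTensor H x) =
        T p ((TensorProduct.assoc ℂ P H H).symm (comul.lTensor P x)) := by
    induction x with
    | zero => simp
    | add x y hx hy => simp only [map_add, hx, hy]
    | tmul q a =>
      simp only [T, coactionRight, LinearMap.comp_apply, LinearMap.lTensor_tmul,
        LinearMap.rTensor_tmul, LinearEquiv.coe_coe]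
      generalize comul (R := ℂ) a = y
      induction y with
      | zero => simp
      | add x y hx hy => simp only [tmul_add, map_add, hx, hy]
      | tmul x y => simp
  ext p q
  have h := congr($hρ q)
  simp only [LinearMap.comp_apply, LinearEquiv.coe_coe] at h
  simp only [curry_apply, LinearMap.comp_apply, LinearMap.restrictScalars_self,
    AlgebraTensorModule.curry_apply]
  rw [verSharp_tmul, h2, ← h, ← h1]
  rfl

/-- The map `p ⊗ h ↦ p₀ ⊗ h₂ ⊗ p₁ S h₁`. -/
noncomputable def twistedCoaction (ρ : P →ₗ[ℂ] P ⊗[ℂ] H) :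
    P ⊗[ℂ] H →ₗ[ℂ] (P ⊗[ℂ] H) ⊗[ℂ] H :=
  (LinearMap.mul' ℂ H).lTensor (P ⊗[ℂ] H) ∘ₗ
    (TensorProduct.tensorTensorTensorComm ℂ P H H H).toLinearMap ∘ₗ
      TensorProduct.map ρ (antipodeCoaction ℂ H)

/-- The canonical map is colinear for the coactions involving the left tensor factors. -/
lemma twistedCoaction_comp_verSharp {ρ : P →ₐ[ℂ] P ⊗[ℂ] H}
    (hρ : ρ.toLinearMap.rTensor H ∘ₗ ρ.toLinearMap =
      (TensorProduct.assoc ℂ P H H).symm.toLinearMap ∘ₗ comul.lTensor P ∘ₗ ρ.toLinearMap) :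
    twistedCoaction ρ.toLinearMap ∘ₗ verSharp ρ.toLinearMap =
      (verSharp ρ.toLinearMap).rTensor H ∘ₗ coactionLeft P ρ.toLinearMap := by
  let K (x : P ⊗[ℂ] H) : (P ⊗[ℂ] H) ⊗[ℂ] H →ₗ[ℂ] (P ⊗[ℂ] H) ⊗[ℂ] H :=
    (LinearMap.mul' ℂ H).lTensor (P ⊗[ℂ] H) ∘ₗ
      (TensorProduct.tensorTensorTensorComm ℂ P H H H).toLinearMap ∘ₗ
        TensorProduct.map (LinearMap.mulLeft ℂ x) (antipodeCoaction ℂ H)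
  have h1 (p : P) (y : P ⊗[ℂ] H) : twistedCoaction ρ.toLinearMap
      ((LinearMap.mulLeft ℂ p).rTensor H y) = K (ρ p) (ρ.toLinearMap.rTensor H y) := by
    induction y with
    | zero => simp
    | add x y hx hy => simp only [map_add, hx, hy]
    | tmul u c => simp [K, twistedCoaction]
  have h2 (p u : P) (a : H) (z : H ⊗[ℂ] H) :
      K (p ⊗ₜ a) ((TensorProduct.assoc ℂ P H H).symm (u ⊗ₜ z)) =
        TensorProduct.map (TensorProduct.mk ℂ P H (p * u)) (LinearMap.mulLeft ℂ a)
          ((LinearMap.mul' ℂ H).lTensor H (TensorProduct.leftComm ℂ H H H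
            ((antipodeCoaction ℂ H).lTensor H z))) := by
    induction z with
    | zero => simp
    | add x y hx hy => simp only [tmul_add, map_add, hx, hy]
    | tmul b c =>
      simp only [K, LinearMap.comp_apply, LinearMap.lTensor_tmul, TensorProduct.map_tmul,
        TensorProduct.assoc_symm_tmul, LinearEquiv.coe_coe]
      generalize antipodeCoaction ℂ H c = y
      induction y with
      | zero => simp
      | add x y hx hy => simp only [tmul_add, map_add, hx, hy]
      | tmul x y => simp [mul_assoc]
  have h3 (x : P ⊗[ℂ] H) (q : P) :
      K x ((TensorProduct.assoc ℂ P H H).symm (comul.lTensor P (ρ q))) =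
        (verSharp ρ.toLinearMap).rTensor H (TensorProduct.rightComm ℂ P H P (x ⊗ₜ q)) := by
    induction x with
    | zero => simp [K]
    | add x y hx hy =>
      have hK : K (x + y) = K x + K y := by
        have hmul : LinearMap.mulLeft ℂ (x + y) =
            LinearMap.mulLeft ℂ x + LinearMap.mulLeft ℂ y := by
          ext; simp [add_mul]
        simp only [K, hmul, TensorProduct.map_add_left, LinearMap.comp_add]
      rw [hK, LinearMap.add_apply, hx, hy, add_tmul, map_add, map_add]
    | tmul p a =>
      rw [TensorProduct.rightComm_tmul, LinearMap.rTensor_tmul, verSharp_tmul]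
      simp only [AlgHom.toLinearMap_apply]
      generalize ρ q = y
      induction y with
      | zero => simp
      | add x y hx hy => simp only [map_add, add_tmul, hx, hy]
      | tmul u c =>
        rw [LinearMap.lTensor_tmul, h2, lTensor_mul_leftComm_antipodeCoaction]
        simp
  ext p q
  have h := congr($hρ q)
  simp only [LinearMap.comp_apply, LinearEquiv.coe_coe, AlgHom.toLinearMap_apply] at h
  simp only [curry_apply, LinearMap.comp_apply, LinearMap.restrictScalars_self,
    AlgebraTensorModule.curry_apply]
  rw [verSharp_tmul, h1, AlgHom.toLinearMap_apply, h, h3]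
  rfl

end Canonical

end HopfAlgebra

open HopfAlgebra

/-- if `H` is a Hopf algebra over `ℂ` with bijective antipode admitting a
normalised left integral, and `P` is a right `H`-comodule algebra whose lifted canonical
map `ver♯` is surjective, then there exists a strong universal connection
`ω♯ : H → P ⊗ P`, i.e. a linear map satisfying `ω♯(1) = 1 ⊗ 1`,
`ver♯ ∘ ω♯ = (1 ⊗ ·)`, and the two compatibility conditions
`h⁽¹⁾ ⊗ (h⁽²⁾)₍₀₎ ⊗ (h⁽²⁾)₍₁₎ = (h₍₁₎)⁽¹⁾ ⊗ (h₍₁₎)⁽²⁾ ⊗ h₍₂₎` and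
`(h⁽¹⁾)₍₀₎ ⊗ (h⁽¹⁾)₍₁₎ ⊗ h⁽²⁾ = (h₍₂₎)⁽¹⁾ ⊗ S h₍₁₎ ⊗ (h₍₂₎)⁽²⁾`. -/
theorem statement0
    (H : Type*) [Ring H] [HopfAlgebra ℂ H]
    -- the antipode is bijective
    (hS : Function.Bijective (HopfAlgebra.antipode (R := ℂ) (A := H)))
    -- a normalised left integral ∫ : H → ℂ
    (int : H →ₗ[ℂ] ℂ)
    (hint1 : int 1 = 1)
    (hint : ∀ h : H,
      (TensorProduct.rid ℂ H) (TensorProduct.map LinearMap.id int (Coalgebra.comul (R := ℂ) h))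
        = int h • (1 : H))
    -- P, a right H-comodule algebra:
    (P : Type*) [Ring P] [Algebra ℂ P]
    (ΔR : P →ₐ[ℂ] P ⊗[ℂ] H)
    (hcoassoc :
      (TensorProduct.map ΔR.toLinearMap LinearMap.id) ∘ₗ ΔR.toLinearMap
        = (TensorProduct.assoc ℂ P H H).symm.toLinearMap ∘ₗ
            (TensorProduct.map LinearMap.id (Coalgebra.comul (R := ℂ))) ∘ₗ ΔR.toLinearMap)
    (hcounit :
      (TensorProduct.rid ℂ P).toLinearMap ∘ₗ
          (TensorProduct.map LinearMap.id (Coalgebra.counit (R := ℂ))) ∘ₗ ΔR.toLinearMap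
        = LinearMap.id)
    -- the lifted canonical map is surjective
    (hsurj : Function.Surjective (verSharp ΔR.toLinearMap)) :
    ∃ ω : H →ₗ[ℂ] P ⊗[ℂ] P,
      ω 1 = 1 ⊗ₜ[ℂ] 1 ∧
      (∀ h : H, verSharp ΔR.toLinearMap (ω h) = 1 ⊗ₜ[ℂ] h) ∧
      (TensorProduct.map LinearMap.id ΔR.toLinearMap) ∘ₗ ω
        = (TensorProduct.assoc ℂ P P H).toLinearMap ∘ₗ
            (TensorProduct.map ω LinearMap.id) ∘ₗ Coalgebra.comul (R := ℂ) ∧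
      (TensorProduct.map ΔR.toLinearMap LinearMap.id) ∘ₗ ω
        = (TensorProduct.assoc ℂ P H P).symm.toLinearMap ∘ₗ
            (TensorProduct.leftComm ℂ H P P).toLinearMap ∘ₗ
              (TensorProduct.map (HopfAlgebra.antipode (R := ℂ) (A := H)) ω) ∘ₗ
                Coalgebra.comul := by
  change ∀ h : H, TensorProduct.rid ℂ H (int.lTensor H (Coalgebra.comul h)) = int h • 1 at hint
  change ΔR.toLinearMap.rTensor H ∘ₗ ΔR.toLinearMap =
    (TensorProduct.assoc ℂ P H H).symm.toLinearMap ∘ₗ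
      (Coalgebra.comul (R := ℂ)).lTensor P ∘ₗ ΔR.toLinearMap at hcoassoc
  set ρ := ΔR.toLinearMap with hρ
  have hρ1 : ρ 1 = 1 ⊗ₜ 1 := map_one ΔR
  have hcomul : (Coalgebra.comul (R := ℂ) (A := H)).rTensor H ∘ₗ Coalgebra.comul =
      (TensorProduct.assoc ℂ H H H).symm.toLinearMap ∘ₗ
        (Coalgebra.comul (R := ℂ)).lTensor H ∘ₗ Coalgebra.comul := by
    ext h
    exact (Coalgebra.coassoc_symm_apply h).symm
  have hcounit' : (TensorProduct.rid ℂ H).toLinearMap ∘ₗ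
      (Coalgebra.counit (R := ℂ)).lTensor H ∘ₗ Coalgebra.comul = LinearMap.id := by
    ext h
    simp
  let j : H →ₗ[ℂ] P ⊗[ℂ] H := TensorProduct.mk ℂ P H 1
  obtain ⟨s, hs⟩ := (verSharp ρ).exists_rightInverse_of_surjective
    (LinearMap.range_eq_top.mpr hsurj)
  let f : H →ₗ[ℂ] P ⊗[ℂ] P :=
    s ∘ₗ j + (Coalgebra.counit (R := ℂ)).smulRight (1 ⊗ₜ 1 - s (j 1))
  have hs' (x : P ⊗[ℂ] H) : verSharp ρ (s x) = x := congr($hs x)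
  have hver1 : verSharp ρ (1 ⊗ₜ 1) = j 1 := by
    rw [verSharp_tmul, hρ1]
    simp [j]
  have hf1 : f 1 = 1 ⊗ₜ 1 := by simp [f]
  have hfver : verSharp ρ ∘ₗ f = j := by
    ext h
    simp [f, hs', hver1]
  let g := average int Coalgebra.comul (coactionRight P ρ) f
  let ω := average int (antipodeCoaction ℂ H) (coactionLeft P ρ) g
  have hg : coactionRight P ρ ∘ₗ g = g.rTensor H ∘ₗ Coalgebra.comul :=
    average_colinear int hint hcomul (coactionRight_coassoc hcoassoc) f
  have hωr : coactionRight P ρ ∘ₗ ω = ω.rTensor H ∘ₗ Coalgebra.comul :=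
    average_comm int antipodeCoaction_comm coactionRight_comm_coactionLeft hg
  have hωl : coactionLeft P ρ ∘ₗ ω = ω.rTensor H ∘ₗ antipodeCoaction ℂ H :=
    average_colinear int hint antipodeCoaction_coassoc (coactionLeft_coassoc hcoassoc) g
  have hgver : verSharp ρ ∘ₗ g = j := by
    rw [comp_average int (coactionRight_comp_verSharp hcoassoc), hfver]
    refine average_eq_self int hint1 hcomul hcounit' ?_
    ext h
    simp only [coactionRight, j, LinearMap.comp_apply, TensorProduct.mk_apply,
      LinearMap.lTensor_tmul, LinearEquiv.coe_coe]
    generalize Coalgebra.comul (R := ℂ) h = y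
    induction y with
    | zero => simp
    | add x y hx hy => simp only [tmul_add, map_add, hx, hy]
    | tmul x y => simp
  have hωver : verSharp ρ ∘ₗ ω = j := by
    rw [comp_average int (twistedCoaction_comp_verSharp hcoassoc), hgver]
    refine average_eq_self int hint1 antipodeCoaction_coassoc antipodeCoaction_counit ?_
    ext h
    simp only [twistedCoaction, j, LinearMap.comp_apply, TensorProduct.mk_apply,
      TensorProduct.map_tmul, LinearEquiv.coe_coe, ← hρ, hρ1]
    generalize antipodeCoaction ℂ H h = y
    induction y with
    | zero => simp
    | add x y hx hy => simp only [tmul_add, map_add, hx, hy]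
    | tmul x y => simp
  have hr1 : coactionRight P ρ (1 ⊗ₜ 1) = (1 ⊗ₜ 1) ⊗ₜ 1 := by simp [coactionRight, hρ1]
  have hl1 : coactionLeft P ρ (1 ⊗ₜ 1) = (1 ⊗ₜ 1) ⊗ₜ 1 := by simp [coactionLeft, hρ1]
  have hg1 : g 1 = 1 ⊗ₜ 1 := average_apply_eq_self int hint1 (Bialgebra.comul_one) hr1 hf1
  have hα1 : antipodeCoaction ℂ H 1 = 1 ⊗ₜ 1 := by
    simp [antipodeCoaction, Algebra.TensorProduct.one_def]
  refine ⟨ω, average_apply_eq_self int hint1 hα1 hl1 hg1, fun h => congr($hωver h), ?_, ?_⟩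
  · change ρ.lTensor P ∘ₗ ω = (TensorProduct.assoc ℂ P P H).toLinearMap ∘ₗ
      (ω.rTensor H ∘ₗ Coalgebra.comul)
    rw [← hωr]
    ext h
    simp [coactionRight]
  · have key (x : H ⊗[ℂ] H) : (TensorProduct.rightComm ℂ P H P).symm
        (ω.rTensor H ((antipode ℂ).lTensor H (TensorProduct.comm ℂ H H x))) =
          (TensorProduct.assoc ℂ P H P).symm (TensorProduct.leftComm ℂ H P P
            (TensorProduct.map (antipode ℂ) ω x)) := by
      induction x with
      | zero => simp
      | add x y hx hy => simp only [map_add, hx, hy]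
      | tmul a b =>
        simp only [TensorProduct.comm_tmul, LinearMap.lTensor_tmul, LinearMap.rTensor_tmul,
          TensorProduct.map_tmul]
        generalize ω b = y
        induction y with
        | zero => simp
        | add x y hx hy => simp only [tmul_add, add_tmul, map_add, hx, hy]
        | tmul x y => simp
    ext h
    refine Eq.trans ?_ (key (Coalgebra.comul h))
    rw [LinearEquiv.eq_symm_apply]
    exact congr($hωl h)
end

section
/- In the Case 3 setup, the assignment c_{,r} ⊗ b_{,t} ↦ (cb)_{,r} ⊗ δ_t (for b, c ∈ B and r, t ∈ ℤ_n) induces a well-defined bijective left P-module map u : P ⊗_A P → P ⊗ ℂ[ℤ_n], where the left action on the target is multiplication on the first tensor factor. -/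
open TensorProduct
open scoped Classical

/-! Case 3 setup: `B` a unital ℂ-algebra, `n ≥ 1`, `P = B^{⊕n}` the direct product of
`n` copies of `B`, realised as `ℤ_n → B`.  For `b : B` and `s : ℤ_n`, `b_{,s}` is
`Pi.single s b`.  `A ⊆ P` is the diagonal subalgebra, and `ℤ_n` acts on `P` by the
shift `(i ▷ p) t = p (t − i)`, so that `i ▷ b_{,s} = b_{,s+i}`. -/

variable (B : Type*) [Ring B] [Algebra ℂ B] (n : ℕ) [NeZero n]

/-- `P = B^{⊕n}`. -/
abbrev PB := ZMod n → B

/-- The diagonal subalgebra `A = {(b,…,b) : b ∈ B}`, as a set. -/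
def Aset : Set (PB B n) := Set.range (fun b : B => (fun _ => b : PB B n))

/-- The shift action of `i ∈ ℤ_n` on `P`, `i ▷ b_{,s} = b_{,s+i}`. -/
noncomputable def shift (i : ZMod n) : PB B n →ₗ[ℂ] PB B n :=
  LinearMap.funLeft ℂ B (fun t => t - i)

/-- The balancing relations over `A` inside `P ⊗[ℂ] P`; the quotient by this submodule
is the balanced tensor product `P ⊗_A P`. -/
noncomputable def relSub : Submodule ℂ (PB B n ⊗[ℂ] PB B n) :=
  Submodule.span ℂ
    {x | ∃ p q a : PB B n, a ∈ Aset B n ∧ x = (p * a) ⊗ₜ[ℂ] q - p ⊗ₜ[ℂ] (a * q)}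

/-- The lifted canonical map `Can : P ⊗ P → P ⊗ ℂ[ℤ_n]`,
`p ⊗ q ↦ Σ_i p·(i▷q) ⊗ δ_i`. -/
noncomputable def Can : (PB B n ⊗[ℂ] PB B n) →ₗ[ℂ] (PB B n ⊗[ℂ] (ZMod n → ℂ)) :=
  ∑ i : ZMod n,
    ((TensorProduct.mk ℂ (PB B n) (ZMod n → ℂ)).flip (Pi.single i 1)) ∘ₗ
      (LinearMap.mul' ℂ (PB B n)) ∘ₗ
        (TensorProduct.map LinearMap.id (shift B n i))

/-- The embedding of `B` into `P = B^{⊕n}` as the diagonal subalgebra. -/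
noncomputable def diagonalMap : B →ₗ[ℂ] PB B n :=
  LinearMap.pi fun _ => LinearMap.id

/-- The map `P ⊗ P → P ⊗ ℂ[ℤ_n]`, `p ⊗ q ↦ Σ_t p·(q_t,…,q_t) ⊗ δ_t`. -/
noncomputable def unbalancedMap : (PB B n ⊗[ℂ] PB B n) →ₗ[ℂ] (PB B n ⊗[ℂ] (ZMod n → ℂ)) :=
  ∑ t : ZMod n,
    ((TensorProduct.mk ℂ (PB B n) (ZMod n → ℂ)).flip (Pi.single t 1)) ∘ₗ
      (LinearMap.mul' ℂ (PB B n)) ∘ₗ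
        (TensorProduct.map LinearMap.id (diagonalMap B n ∘ₗ LinearMap.proj t))

lemma unbalancedMap_tmul (p q : PB B n) :
    unbalancedMap B n (p ⊗ₜ[ℂ] q) =
      ∑ t : ZMod n, (p * fun _ => q t) ⊗ₜ[ℂ] (Pi.single t 1 : ZMod n → ℂ) := by
  simp only [unbalancedMap, LinearMap.sum_apply]
  rfl

lemma relSub_le_ker_unbalancedMap : relSub B n ≤ LinearMap.ker (unbalancedMap B n) := by
  refine Submodule.span_le.2 ?_
  rintro _ ⟨p, q, _, ⟨b, rfl⟩, rfl⟩
  simp only [SetLike.mem_coe, LinearMap.mem_ker, map_sub, unbalancedMap_tmul, sub_eq_zero]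
  refine Finset.sum_congr rfl fun t _ => ?_
  rw [mul_assoc]
  rfl

/-- The map `P ⊗_A P → P ⊗ ℂ[ℤ_n]` induced by `unbalancedMap`. -/
noncomputable def balancedMap :
    ((PB B n ⊗[ℂ] PB B n) ⧸ relSub B n) →ₗ[ℂ] (PB B n ⊗[ℂ] (ZMod n → ℂ)) :=
  (relSub B n).liftQ (unbalancedMap B n) (relSub_le_ker_unbalancedMap B n)

lemma balancedMap_mkQ_tmul (p q : PB B n) :
    balancedMap B n ((relSub B n).mkQ (p ⊗ₜ[ℂ] q)) =
      ∑ t : ZMod n, (p * fun _ => q t) ⊗ₜ[ℂ] (Pi.single t 1 : ZMod n → ℂ) :=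
  unbalancedMap_tmul B n p q

/-- The map `P ⊗ ℂ[ℤ_n] → P ⊗_A P` induced by the inclusion `ℂ[ℤ_n] → P`. -/
noncomputable def balancedMapInv :
    (PB B n ⊗[ℂ] (ZMod n → ℂ)) →ₗ[ℂ] ((PB B n ⊗[ℂ] PB B n) ⧸ relSub B n) :=
  (relSub B n).mkQ ∘ₗ
    TensorProduct.map LinearMap.id ((Algebra.linearMap ℂ B).compLeft (ZMod n))

lemma balancedMapInv_tmul (p : PB B n) (f : ZMod n → ℂ) :
    balancedMapInv B n (p ⊗ₜ[ℂ] f) =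
      (relSub B n).mkQ (p ⊗ₜ[ℂ] fun t => algebraMap ℂ B (f t)) :=
  rfl

lemma mkQ_mul_const_tmul (p q : PB B n) (b : B) :
    (relSub B n).mkQ ((p * fun _ => b) ⊗ₜ[ℂ] q) =
      (relSub B n).mkQ (p ⊗ₜ[ℂ] ((fun _ => b) * q)) :=
  (Submodule.Quotient.eq _).2 (Submodule.subset_span ⟨p, q, fun _ => b, ⟨b, rfl⟩, rfl⟩)

lemma balancedMapInv_comp_balancedMap :
    balancedMapInv B n ∘ₗ balancedMap B n = LinearMap.id := by
  refine Submodule.linearMap_qext _ (TensorProduct.ext' fun p q => ?_)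
  simp only [LinearMap.comp_apply, balancedMap_mkQ_tmul, map_sum, balancedMapInv_tmul,
    mkQ_mul_const_tmul, LinearMap.id_apply]
  rw [← map_sum, ← TensorProduct.tmul_sum]
  congr 2
  ext s
  simp [Finset.sum_apply, Pi.single_apply, apply_ite (algebraMap ℂ B)]

lemma balancedMap_comp_balancedMapInv :
    balancedMap B n ∘ₗ balancedMapInv B n = LinearMap.id := by
  refine TensorProduct.ext' fun p f => ?_
  simp only [LinearMap.comp_apply, balancedMapInv_tmul, balancedMap_mkQ_tmul, LinearMap.id_apply]
  have key (t : ZMod n) : (p * fun _ => algebraMap ℂ B (f t)) = f t • p := by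
    ext s
    simp [Algebra.smul_def, Algebra.commutes]
  simp only [key, TensorProduct.smul_tmul]
  rw [← TensorProduct.tmul_sum]
  congr 1
  ext s
  simp [Finset.sum_apply, Pi.single_apply]

/-- the assignment `c_{,r} ⊗ b_{,t} ↦ (cb)_{,r} ⊗ δ_t` induces a
well-defined bijective left `P`-module map `u : P ⊗_A P → P ⊗ ℂ[ℤ_n]`. -/
theorem statement10 :
    ∃ u : ((PB B n ⊗[ℂ] PB B n) ⧸ relSub B n) →ₗ[ℂ] (PB B n ⊗[ℂ] (ZMod n → ℂ)),
      (∀ (c b : B) (r t : ZMod n),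
        u ((relSub B n).mkQ (Pi.single r c ⊗ₜ[ℂ] Pi.single t b))
          = Pi.single r (c * b) ⊗ₜ[ℂ] Pi.single t (1 : ℂ)) ∧
      Function.Bijective u ∧
      (∀ p : PB B n,
        u ∘ₗ (relSub B n).mkQ ∘ₗ TensorProduct.map (LinearMap.mulLeft ℂ p) LinearMap.id
          = TensorProduct.map (LinearMap.mulLeft ℂ p) LinearMap.id ∘ₗ
              u ∘ₗ (relSub B n).mkQ) := by
  refine ⟨balancedMap B n, fun c b r t => ?_, ?_, fun p => TensorProduct.ext' fun x y => ?_⟩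
  · rw [balancedMap_mkQ_tmul, Finset.sum_eq_single t]
    · congr 1
      ext s
      by_cases h : s = r
      · subst h; simp
      · simp [h]
    · intro s _ hs
      have h0 : (Pi.single r c * fun _ => (Pi.single t b : PB B n) s : PB B n) = 0 := by
        ext
        simp [hs]
      rw [h0, TensorProduct.zero_tmul]
    · simp
  · exact Function.bijective_iff_has_inverse.2 ⟨balancedMapInv B n,
      LinearMap.congr_fun (balancedMapInv_comp_balancedMap B n),
      LinearMap.congr_fun (balancedMap_comp_balancedMapInv B n)⟩
  · simp only [LinearMap.comp_apply, TensorProduct.map_tmul, balancedMap_mkQ_tmul, map_sum,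
      LinearMap.mulLeft_apply, LinearMap.id_apply, mul_assoc]
end
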